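/- Let U and V be two plane domains with smooth boundaries and let f: ∂U → ∂V be a bijective mapping that is a local isometry of the boundaries in the relative metrics; assume moreover that ∂U is bounded. Then ∂V is also bounded, and f has the following uniform property: there exists a number ε > 0 such that ρ_{∂U,U}(a,b) = ρ_{∂V,V}(f(a),f(b)) whenever a,b ∈ ∂U and ρ_{∂U,U}(a,b) < ε. -/

import Mathlib

open Set Filter Metric Topology ENNReal

noncomputable section

/-- A domain in `ℝⁿ`: a nonempty open connected set. -/
def IsDomainSet {n : ℕ} (U : Set (EuclideanSpace ℝ (Fin n))) : Prop :=
  IsOpen U ∧ IsConnected U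

/-- The infimum of lengths of smooth paths joining `a` and `b` inside `U`. -/
def smoothPathInf {n : ℕ} (U : Set (EuclideanSpace ℝ (Fin n)))
    (a b : EuclideanSpace ℝ (Fin n)) : ℝ≥0∞ :=
  ⨅ (γ : ℝ → EuclideanSpace ℝ (Fin n)) (_ : ContDiff ℝ 1 γ) (_ : γ 0 = a)
    (_ : γ 1 = b) (_ : ∀ t ∈ Icc (0:ℝ) 1, γ t ∈ U), eVariationOn γ (Icc 0 1)

/-- The relative metric `ρ_{∂U,U}`:
`ρ(x,y) = liminf_{x'→x, y'→y; x',y'∈U} inf{length γ : γ smooth path joining x',y' in U}`. -/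
def relDist {n : ℕ} (U : Set (EuclideanSpace ℝ (Fin n)))
    (x y : EuclideanSpace ℝ (Fin n)) : ℝ≥0∞ :=
  Filter.liminf (fun p : EuclideanSpace ℝ (Fin n) × EuclideanSpace ℝ (Fin n) =>
    smoothPathInf U p.1 p.2) ((𝓝[U] x) ×ˢ (𝓝[U] y))

/-- `f` is a bijection of `∂U` onto `∂V` which is a local isometry
in the relative metrics of the boundaries. -/
def IsBoundaryLocalIsometry {n : ℕ} (U V : Set (EuclideanSpace ℝ (Fin n)))
    (f : EuclideanSpace ℝ (Fin n) → EuclideanSpace ℝ (Fin n)) : Prop :=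
  Set.BijOn f (frontier U) (frontier V) ∧
  ∀ y ∈ frontier U, ∃ ε : ℝ≥0∞, 0 < ε ∧ ∀ a ∈ frontier U, ∀ b ∈ frontier U,
    relDist U a y < ε → relDist U b y < ε →
      relDist U a b = relDist V (f a) (f b)

/-- `U` has smooth boundary: `∂U` is an `(n-1)`-dimensional submanifold of
class `C¹` without boundary, i.e. near each of its points the frontier can be
mapped by a `C¹` diffeomorphism onto an open piece of a hyperplane. -/
def HasC1Boundary {n : ℕ} (U : Set (EuclideanSpace ℝ (Fin n))) : Prop :=
  ∀ x ∈ frontier U, ∃ (W W' : Set (EuclideanSpace ℝ (Fin n)))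
    (φ ψ : EuclideanSpace ℝ (Fin n) → EuclideanSpace ℝ (Fin n))
    (ℓ : EuclideanSpace ℝ (Fin n) →L[ℝ] ℝ),
    IsOpen W ∧ x ∈ W ∧ IsOpen W' ∧ ℓ ≠ 0 ∧
    ContDiffOn ℝ 1 φ W ∧ ContDiffOn ℝ 1 ψ W' ∧
    Set.MapsTo φ W W' ∧ Set.MapsTo ψ W' W ∧
    (∀ z ∈ W, ψ (φ z) = z) ∧ (∀ z ∈ W', φ (ψ z) = z) ∧
    φ '' (W ∩ frontier U) = W' ∩ {y | ℓ y = 0}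

/-- The intrinsic distance inside a set `S`: the infimum of lengths of
(continuous) paths joining `a` and `b` inside `S`. -/
def intrinsicDist {n : ℕ} (S : Set (EuclideanSpace ℝ (Fin n)))
    (a b : EuclideanSpace ℝ (Fin n)) : ℝ≥0∞ :=
  ⨅ (γ : ℝ → EuclideanSpace ℝ (Fin n)) (_ : ContinuousOn γ (Icc (0:ℝ) 1))
    (_ : γ 0 = a) (_ : γ 1 = b) (_ : ∀ t ∈ Icc (0:ℝ) 1, γ t ∈ S),
    eVariationOn γ (Icc 0 1)

section RelativeMetric

variable {n : ℕ} {U : Set (EuclideanSpace ℝ (Fin n))}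

lemma edist_le_smoothPathInf (a b : EuclideanSpace ℝ (Fin n)) :
    edist a b ≤ smoothPathInf U a b := by
  refine le_iInf fun γ => le_iInf fun _ => le_iInf fun h0 => le_iInf fun h1 => le_iInf fun _ => ?_
  rw [← h0, ← h1]
  exact eVariationOn.edist_le γ (by simp) (by simp)

lemma edist_le_relDist (a b : EuclideanSpace ℝ (Fin n)) (ha : a ∈ closure U)
    (hb : b ∈ closure U) : edist a b ≤ relDist U a b := by
  have := mem_closure_iff_nhdsWithin_neBot.1 ha
  have := mem_closure_iff_nhdsWithin_neBot.1 hb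
  have h : Tendsto (fun p : EuclideanSpace ℝ (Fin n) × EuclideanSpace ℝ (Fin n) =>
      edist p.1 p.2) (𝓝[U] a ×ˢ 𝓝[U] b) (𝓝 (edist a b)) := by
    have hc := (continuous_edist (α := EuclideanSpace ℝ (Fin n))).tendsto (a, b)
    rw [nhds_prod_eq] at hc
    exact hc.mono_left (Filter.prod_mono nhdsWithin_le_nhds nhdsWithin_le_nhds)
  rw [← h.liminf_eq]
  exact liminf_le_liminf (Eventually.of_forall fun p => edist_le_smoothPathInf p.1 p.2)

/-- The relative distance is controlled along any one-parameter approach to the two points. -/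
lemma relDist_le_of_tendsto {ι : Type*} {l : Filter ι} [l.NeBot] {a b : EuclideanSpace ℝ (Fin n)}
    {u v : ι → EuclideanSpace ℝ (Fin n)} (hu : Tendsto u l (𝓝[U] a)) (hv : Tendsto v l (𝓝[U] b))
    {C : ℝ≥0∞} (h : ∀ᶠ i in l, smoothPathInf U (u i) (v i) ≤ C) : relDist U a b ≤ C :=
  liminf_le_of_frequently_le ((hu.prodMk hv).frequently h.frequently)

/-- The image of a segment under a `C¹` Lipschitz map is an admissible path. -/
lemma smoothPathInf_le_of_lipschitzOnWith {ψ : EuclideanSpace ℝ (Fin n) → EuclideanSpace ℝ (Fin n)}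
    {S W' : Set (EuclideanSpace ℝ (Fin n))} {K : NNReal} (hW' : IsOpen W')
    (hψ : ContDiffOn ℝ 1 ψ W') (hSW : S ⊆ W') (hS : Convex ℝ S) (hL : LipschitzOnWith K ψ S)
    (hSU : MapsTo ψ S U) {p q : EuclideanSpace ℝ (Fin n)} (hp : p ∈ S) (hq : q ∈ S) :
    smoothPathInf U (ψ p) (ψ q) ≤ K * edist p q := by
  set g : ℝ → EuclideanSpace ℝ (Fin n) := fun t => AffineMap.lineMap p q (Real.smoothTransition t)
    with hg
  have hgS : ∀ t, g t ∈ S := fun t =>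
    hS.lineMap_mem hp hq ⟨Real.smoothTransition.nonneg t, Real.smoothTransition.le_one t⟩
  have hgC : ContDiff ℝ 1 g := by
    have h1 : ContDiff ℝ 1 Real.smoothTransition := Real.smoothTransition.contDiff (n := 1)
    simp only [hg, AffineMap.lineMap_apply_module]
    fun_prop
  have hC : ContDiff ℝ 1 (ψ ∘ g) := contDiff_iff_contDiffAt.2 fun t =>
    ((hψ.contDiffAt (hW'.mem_nhds (hSW (hgS t))))).comp t hgC.contDiffAt
  have hle : smoothPathInf U (ψ p) (ψ q) ≤ eVariationOn (ψ ∘ g) (Icc 0 1) := by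
    unfold smoothPathInf
    exact iInf₂_le_of_le (ψ ∘ g) hC <| iInf₂_le_of_le (by simp [hg]) (by simp [hg]) <|
      iInf_le _ fun t _ => hSU (hgS t)
  refine hle.trans ?_
  refine (hL.comp_eVariationOn_le fun t _ => hgS t).trans ?_
  gcongr
  have hline : LipschitzOnWith (nndist p q) (AffineMap.lineMap p q : ℝ → EuclideanSpace ℝ (Fin n))
      univ := (lipschitzWith_lineMap p q).lipschitzOnWith
  refine (hline.comp_eVariationOn_le (mapsTo_univ Real.smoothTransition _)).trans ?_
  have hm := (Real.smoothTransition.monotone.monotoneOn (Icc (0 : ℝ) 1)).eVariationOn_eq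
    (a := 0) (b := 1) (by simp) (by simp)
  rw [inter_self] at hm
  rw [hm, edist_nndist]
  simp

lemma IsPreconnected.subset_of_disjoint_frontier {X : Type*} [TopologicalSpace X] {s U : Set X}
    (hs : IsPreconnected s) (hU : IsOpen U) (hd : Disjoint s (frontier U))
    (hne : (s ∩ U).Nonempty) : s ⊆ U := by
  refine hs.subset_left_of_subset_union hU isClosed_closure.isOpen_compl
    (disjoint_compl_right.mono_left subset_closure) (fun z hz => ?_) hne
  by_contra h
  simp only [mem_union, mem_compl_iff, not_or, not_not] at h
  exact hd.le_bot ⟨hz, h.2, fun h' => h.1 (interior_subset h')⟩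

/-- Near a boundary point, the relative distance on the boundary is at most a multiple of the
Euclidean distance measured in a chart, provided the side `0 < ℓ` of the chart meets `U`
arbitrarily close to the point. -/
lemma relDist_le_of_chart (hU : IsOpen U) {x : EuclideanSpace ℝ (Fin n)}
    {W W' : Set (EuclideanSpace ℝ (Fin n))}
    {φ ψ : EuclideanSpace ℝ (Fin n) → EuclideanSpace ℝ (Fin n)}
    {ℓ : EuclideanSpace ℝ (Fin n) →L[ℝ] ℝ} {S : Set (EuclideanSpace ℝ (Fin n))} {K : NNReal}
    (hW' : IsOpen W') (hℓ : ℓ ≠ 0) (hψ : ContDiffOn ℝ 1 ψ W')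
    (hψφ : ∀ z ∈ W, ψ (φ z) = z) (hφψ : ∀ z ∈ W', φ (ψ z) = z) (hmaps : MapsTo ψ W' W)
    (hfr : φ '' (W ∩ frontier U) = W' ∩ {y | ℓ y = 0})
    (hSo : IsOpen S) (hSW : S ⊆ W') (hS : Convex ℝ S) (hL : LipschitzOnWith K ψ S)
    (hpos : ∃ z ∈ W ∩ U, φ z ∈ S ∧ 0 < ℓ (φ z))
    {a : EuclideanSpace ℝ (Fin n)} (haf : a ∈ frontier U) (haW : a ∈ W) (haS : φ a ∈ S)
    (hxf : x ∈ frontier U) (hxW : x ∈ W) (hxS : φ x ∈ S) :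
    relDist U a x ≤ K * edist (φ a) (φ x) := by
  set P : Set (EuclideanSpace ℝ (Fin n)) := S ∩ {y | 0 < ℓ y} with hP
  have hPc : Convex ℝ P := hS.inter (convex_halfSpace_gt ℓ.isLinear 0)
  have hPW : P ⊆ W' := inter_subset_left.trans hSW
  have himg : ψ '' P ⊆ U := by
    refine (hPc.isPreconnected.image ψ (hψ.continuousOn.mono hPW)).subset_of_disjoint_frontier
      hU ?_ ?_
    · rw [Set.disjoint_left]
      rintro _ ⟨w, hw, rfl⟩ hwf
      have h : φ (ψ w) ∈ W' ∩ {y | ℓ y = 0} :=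
        hfr ▸ mem_image_of_mem φ ⟨hmaps (hPW hw), hwf⟩
      rw [hφψ w (hPW hw)] at h
      exact hw.2.ne' h.2
    · obtain ⟨z, hz, hzS, hz0⟩ := hpos
      exact ⟨z, ⟨φ z, ⟨hzS, hz0⟩, hψφ z hz.1⟩, hz.2⟩
  obtain ⟨v, hv⟩ : ∃ v, 0 < ℓ v := by
    obtain ⟨v, hv⟩ : ∃ v, ℓ v ≠ 0 := by
      by_contra! h
      exact hℓ (ContinuousLinearMap.ext h)
    rcases hv.lt_or_gt with h | h
    · exact ⟨-v, by simpa using h⟩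
    · exact ⟨v, h⟩
  have approach : ∀ b ∈ frontier U, b ∈ W → φ b ∈ S →
      Tendsto (fun t : ℝ => φ b + t • v) (𝓝[>] 0) (𝓝 (φ b)) ∧
      ∀ᶠ t : ℝ in 𝓝[>] 0, φ b + t • v ∈ P := by
    intro b hbf hbW hbS
    have ht : Tendsto (fun t : ℝ => φ b + t • v) (𝓝[>] 0) (𝓝 (φ b)) := by
      have hc : Continuous fun t : ℝ => φ b + t • v := by fun_prop
      simpa using (hc.tendsto 0).mono_left nhdsWithin_le_nhds
    refine ⟨ht, ?_⟩
    have hb0 : ℓ (φ b) = 0 := (hfr ▸ mem_image_of_mem φ ⟨hbW, hbf⟩ :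
      φ b ∈ W' ∩ {y | ℓ y = 0}).2
    filter_upwards [ht (hSo.mem_nhds hbS), self_mem_nhdsWithin] with t h1 h2
    refine ⟨h1, ?_⟩
    simpa [hb0] using mul_pos h2 hv
  have approachU : ∀ b ∈ frontier U, b ∈ W → φ b ∈ S →
      Tendsto (fun t : ℝ => ψ (φ b + t • v)) (𝓝[>] 0) (𝓝[U] b) := by
    intro b hbf hbW hbS
    obtain ⟨h1, h2⟩ := approach b hbf hbW hbS
    refine tendsto_nhdsWithin_iff.2 ⟨?_, h2.mono fun t ht => himg (mem_image_of_mem ψ ht)⟩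
    have hc := (hψ.continuousOn.continuousAt (hW'.mem_nhds (hSW hbS))).tendsto.comp h1
    rwa [hψφ b hbW] at hc
  refine relDist_le_of_tendsto (approachU a haf haW haS) (approachU x hxf hxW hxS) ?_
  filter_upwards [(approach a haf haW haS).2, (approach x hxf hxW hxS).2] with t h1 h2
  have h := smoothPathInf_le_of_lipschitzOnWith hW' hψ hPW hPc (hL.mono inter_subset_left)
    (mapsTo_iff_image_subset.2 himg) h1 h2
  rwa [edist_add_right] at h

/-- On a `C¹` boundary, Euclidean convergence implies convergence in the relative metric. -/
lemma tendsto_relDist (hU : IsOpen U) (hUb : HasC1Boundary U) {x : EuclideanSpace ℝ (Fin n)}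
    (hx : x ∈ frontier U) :
    Tendsto (fun a => relDist U a x) (𝓝[frontier U] x) (𝓝 0) := by
  obtain ⟨W, W', φ, ψ, ℓ, hW, hxW, hW', hℓ, hφ, hψ, hφm, hψm, hψφ, hφψ, hfr⟩ := hUb x hx
  have hφx : W' ∈ 𝓝 (φ x) := hW'.mem_nhds (hφm hxW)
  obtain ⟨K, t, ht, hL⟩ := (hψ.contDiffAt hφx).exists_lipschitzOnWith
  obtain ⟨r, hr, hball⟩ := Metric.mem_nhds_iff.1 (inter_mem ht hφx)
  set S := ball (φ x) r
  have hφc : ContinuousAt φ x := hφ.continuousOn.continuousAt (hW.mem_nhds hxW)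
  have hnear : ∀ᶠ a in 𝓝 x, a ∈ W ∧ φ a ∈ S :=
    (hW.eventually_mem hxW).and (hφc (ball_mem_nhds _ hr))
  have hxS : φ x ∈ S := mem_ball_self hr
  have hside : ∃ ℓ' : EuclideanSpace ℝ (Fin n) →L[ℝ] ℝ, ℓ' ≠ 0 ∧
      φ '' (W ∩ frontier U) = W' ∩ {y | ℓ' y = 0} ∧
      ∃ z ∈ W ∩ U, φ z ∈ S ∧ 0 < ℓ' (φ z) := by
    obtain ⟨z, ⟨hzW, hzS⟩, hzU⟩ := mem_closure_iff_nhds.1 hx.1 _ hnear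
    have hz : ℓ (φ z) ≠ 0 := fun h0 => by
      obtain ⟨w, ⟨hwW, hwf⟩, hw⟩ : φ z ∈ φ '' (W ∩ frontier U) := hfr ▸ ⟨hφm hzW, h0⟩
      have hwz : w = z := by rw [← hψφ w hwW, hw, hψφ z hzW]
      rw [hwz, hU.frontier_eq] at hwf
      exact hwf.2 hzU
    rcases hz.lt_or_gt with h | h
    · exact ⟨-ℓ, neg_ne_zero.2 hℓ, by simpa using hfr, z, ⟨hzW, hzU⟩, hzS, by simpa using h⟩
    · exact ⟨ℓ, hℓ, hfr, z, ⟨hzW, hzU⟩, hzS, h⟩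
  obtain ⟨ℓ', hℓ', hfr', hpos⟩ := hside
  have hlim : Tendsto (fun a => K * edist (φ a) (φ x)) (𝓝[frontier U] x) (𝓝 0) := by
    have h := ENNReal.Tendsto.const_mul (a := K)
      (tendsto_iff_edist_tendsto_0.1 hφc.tendsto) (Or.inr coe_ne_top)
    rw [mul_zero] at h
    exact h.mono_left nhdsWithin_le_nhds
  refine tendsto_of_tendsto_of_tendsto_of_le_of_le' tendsto_const_nhds hlim
    (Eventually.of_forall fun _ => zero_le) ?_
  filter_upwards [nhdsWithin_le_nhds hnear, self_mem_nhdsWithin] with a ha haf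
  exact relDist_le_of_chart hU hW' hℓ' hψ hψφ hφψ hψm hfr' isOpen_ball
    (hball.trans inter_subset_right) (convex_ball _ _) (hL.mono (hball.trans inter_subset_left))
    hpos haf ha.1 ha.2 hx hxW hxS

end RelativeMetric

/-- if the boundary of `U` is bounded, then the boundary of `V` is
bounded too, and the local isometry `f` is uniformly locally isometric: there is
a single `ε > 0` such that `f` preserves relative distances which are `< ε`. -/
theorem bounded_boundary_uniform_local_isometry
    (U V : Set (EuclideanSpace ℝ (Fin 2)))
    (hU : IsDomainSet U) (hV : IsDomainSet V)
    (hUb : HasC1Boundary U) (hVb : HasC1Boundary V)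
    (f : EuclideanSpace ℝ (Fin 2) → EuclideanSpace ℝ (Fin 2))
    (hf : IsBoundaryLocalIsometry U V f)
    (hbd : Bornology.IsBounded (frontier U)) :
    Bornology.IsBounded (frontier V) ∧
    ∃ ε : ℝ≥0∞, 0 < ε ∧ ∀ a ∈ frontier U, ∀ b ∈ frontier U,
      relDist U a b < ε → relDist U a b = relDist V (f a) (f b) := by
  obtain ⟨hbij, hloc⟩ := hf
  have hcpt : IsCompact (frontier U) := isCompact_of_isClosed_isBounded isClosed_frontier hbd
  have hzero : ∀ y ∈ frontier U, relDist U y y = 0 := fun y hy =>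
    tendsto_nhds_unique (tendsto_pure_nhds _ y)
      ((tendsto_relDist hU.1 hUb hy).mono_left (pure_le_nhdsWithin hy))
  choose! ε hε hiso using hloc
  have hnhds : ∀ y ∈ frontier U, {a | relDist U a y < ε y} ∈ 𝓝[frontier U] y := fun y hy =>
    (tendsto_relDist hU.1 hUb hy).eventually_lt_const (hε y hy)
  constructor
  · have hcont : ContinuousOn f (frontier U) := by
      intro y hy
      refine tendsto_iff_edist_tendsto_0.2 (tendsto_of_tendsto_of_tendsto_of_le_of_le'
        tendsto_const_nhds (tendsto_relDist hU.1 hUb hy) (Eventually.of_forall fun _ => zero_le)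
        ?_)
      filter_upwards [hnhds y hy, self_mem_nhdsWithin] with a ha haf
      rw [hiso y hy a haf y hy ha ((hzero y hy).symm ▸ hε y hy)]
      exact edist_le_relDist _ _ (hbij.mapsTo haf).1 (hbij.mapsTo hy).1
    rw [← hbij.image_eq]
    exact (hcpt.image_of_continuousOn hcont).isBounded
  · obtain ⟨δ, hδ, hδU⟩ := lebesgue_number_lemma_of_emetric_nhdsWithin' hcpt hnhds
    refine ⟨δ, hδ, fun a ha b hb hab => ?_⟩
    obtain ⟨⟨y, hy⟩, hsub⟩ := hδU a ha
    have hbδ : edist b a < δ :=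
      (edist_comm b a).trans_lt ((edist_le_relDist a b ha.1 hb.1).trans_lt hab)
    exact hiso y hy a ha b hb (hsub ⟨by simpa using hδ, ha⟩) (hsub ⟨hbδ, hb⟩)

end
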